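/- arXiv:math/0306286 — 2 statements merged into one kernel-verified Lean document; each statement's English description precedes it below -/
import Mathlib

section
/- Let x_k be the largest zero of the generalized Laguerre polynomial L_k^{(α)} with α > −1. Then x_k < U² − 3·U^{4/3}·(U² − V²)^{−1/3} + 2, where V = √(k+α+1) − √k and U = √(k+α+1) + √k. -/
/-- The generalized Laguerre polynomial `L_k^{(α)}` as a real function:
`L_k^{(α)}(x) = ∑_{i=0}^{k} ((−1)^i / i!) · (∏_{j=1}^{k−i} (α + i + j))/(k−i)! · x^i`. -/
noncomputable def laguerre (k : ℕ) (α : ℝ) (x : ℝ) : ℝ :=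
  ∑ i ∈ Finset.range (k + 1),
    ((-1 : ℝ) ^ i / (Nat.factorial i)) *
      ((∏ j ∈ Finset.range (k - i), (α + (i : ℝ) + (j : ℝ) + 1)) /
        (Nat.factorial (k - i))) * x ^ i


open Polynomial in
/-- A polynomial times `x^c e^{-bx}` tends to zero. -/
lemma poly_decay (Q : Polynomial ℝ) (c b : ℝ) (hb : 0 < b) :
    Filter.Tendsto (fun x : ℝ => x ^ c * Real.exp (-b * x) * Q.eval x) Filter.atTop (nhds 0) := by
  induction Q using Polynomial.induction_on' with
  | add p q hp hq =>
    have := hp.add hq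
    simp only [add_zero] at this
    refine this.congr (fun x => ?_)
    simp only [eval_add]; ring
  | monomial n a =>
    have h := (tendsto_rpow_mul_exp_neg_mul_atTop_nhds_zero (c + n) b hb).const_mul a
    rw [mul_zero] at h
    refine h.congr' ?_
    filter_upwards [Filter.eventually_gt_atTop 0] with x hx
    rw [Real.rpow_add hx, Real.rpow_natCast, eval_monomial]; ring

open Polynomial in
/-- Sturm comparison with `(x - p) e^{m x}`. -/
lemma sturm_key (P : Polynomial ℝ) (k c m p x0 : ℝ) (hx0 : 0 < x0) (hm : m < 1) (hp : p < x0)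
    (ode : ∀ x : ℝ, x * P.derivative.derivative.eval x + (c - x) * P.derivative.eval x
      + k * P.eval x = 0)
    (hq : ∀ x, x0 < x →
      m ^ 2 * x * (x - p) + 2 * m * x - (x - c) * (m * (x - p) + 1) + k * (x - p) ≤ 0)
    (h0 : P.eval x0 = 0) (hpos : ∀ x, x0 < x → 0 < P.eval x) : False := by
  set R : Polynomial ℝ := P.derivative * (X - C p) - P * (C m * (X - C p) + 1) with hR
  have hRe : ∀ x, R.eval x = P.derivative.eval x * (x - p) - P.eval x * (m * (x - p) + 1) := by
    intro x; simp [hR]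
  have hRd : ∀ x, R.derivative.eval x = P.derivative.derivative.eval x * (x - p)
      + P.derivative.eval x - P.derivative.eval x * (m * (x - p) + 1) - P.eval x * m := by
    intro x; simp [hR]; ring
  set W : ℝ → ℝ := fun x => x ^ c * Real.exp (-(1 - m) * x) * R.eval x with hW
  have hWlim : Filter.Tendsto W Filter.atTop (nhds 0) := poly_decay R c (1 - m) (by linarith)
  have hWd : ∀ x, 0 < x → HasDerivAt W (x ^ (c - 1) * Real.exp (-(1 - m) * x) *
      ((c - (1 - m) * x) * R.eval x + x * R.derivative.eval x)) x := by
    intro x hx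
    have h1 : HasDerivAt (fun x : ℝ => x ^ c) (c * x ^ (c - 1)) x :=
      Real.hasDerivAt_rpow_const (Or.inl hx.ne')
    have h2 : HasDerivAt (fun x : ℝ => Real.exp (-(1 - m) * x))
        (Real.exp (-(1 - m) * x) * (-(1 - m) * 1)) x :=
      ((hasDerivAt_id x).const_mul (-(1 - m))).exp
    have h3 := (h1.mul h2).mul (R.hasDerivAt x)
    refine h3.congr_deriv ?_
    have : x ^ c = x ^ (c - 1) * x := by
      rw [← Real.rpow_add_one hx.ne']; ring_nf
    simp only [Pi.mul_apply]
    rw [this]; ring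
  have hWmono : MonotoneOn W (Set.Ici x0) := by
    apply monotoneOn_of_deriv_nonneg (convex_Ici x0)
    · intro x hx
      exact (hWd x (lt_of_lt_of_le hx0 hx)).continuousAt.continuousWithinAt
    · intro x hx
      rw [interior_Ici] at hx
      exact (hWd x (hx0.trans hx)).differentiableAt.differentiableWithinAt
    · intro x hx
      rw [interior_Ici] at hx
      have hx' : x0 < x := hx
      have hx1 : 0 < x := hx0.trans hx'
      rw [(hWd x hx1).deriv]
      apply mul_nonneg (by positivity)
      have e : (c - (1 - m) * x) * R.eval x + x * R.derivative.eval x =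
          P.eval x * -(m ^ 2 * x * (x - p) + 2 * m * x - (x - c) * (m * (x - p) + 1)
            + k * (x - p)) := by
        rw [hRe, hRd]
        linear_combination (x - p) * ode x
      rw [e]
      exact mul_nonneg (hpos x hx').le (by linarith [hq x hx'])
  have hWneg : ∀ x, x0 ≤ x → W x ≤ 0 := by
    intro x hx
    refine ge_of_tendsto hWlim ?_
    filter_upwards [Filter.eventually_ge_atTop x] with y hy
    exact hWmono hx (hx.trans hy) hy
  have hRneg : ∀ x, x0 ≤ x → R.eval x ≤ 0 := by
    intro x hx
    have h1 := hWneg x hx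
    have hx1 : 0 < x := lt_of_lt_of_le hx0 hx
    have h2 : 0 < x ^ c * Real.exp (-(1 - m) * x) := by positivity
    simp only [hW] at h1
    by_contra h
    push Not at h
    linarith [mul_pos h2 h]
  set G : ℝ → ℝ := fun x => P.eval x * Real.exp (-m * x) / (x - p) with hG
  have hGd : ∀ x, x0 ≤ x → HasDerivAt G (Real.exp (-m * x) * R.eval x / (x - p) ^ 2) x := by
    intro x hx
    have hxp : x - p ≠ 0 := by linarith
    have h2 : HasDerivAt (fun x : ℝ => Real.exp (-m * x))
        (Real.exp (-m * x) * (-m * 1)) x :=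
      ((hasDerivAt_id x).const_mul (-m)).exp
    have h3 := ((P.hasDerivAt x).mul h2).div ((hasDerivAt_id x).sub_const p) hxp
    refine h3.congr_deriv ?_
    simp only [Pi.mul_apply, id]
    rw [hRe]; ring
  have hGanti : AntitoneOn G (Set.Ici x0) := by
    apply antitoneOn_of_deriv_nonpos (convex_Ici x0)
    · intro x hx
      exact (hGd x hx).continuousAt.continuousWithinAt
    · intro x hx
      rw [interior_Ici] at hx
      exact (hGd x (le_of_lt hx)).differentiableAt.differentiableWithinAt
    · intro x hx
      rw [interior_Ici] at hx
      rw [(hGd x (le_of_lt hx)).deriv]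
      apply div_nonpos_of_nonpos_of_nonneg _ (sq_nonneg _)
      exact mul_nonpos_of_nonneg_of_nonpos (Real.exp_pos _).le (hRneg x (le_of_lt hx))
  have h1 := hGanti (Set.mem_Ici.2 le_rfl) (Set.mem_Ici.2 (by linarith : x0 ≤ x0 + 1))
    (by linarith)
  have h2 : G x0 = 0 := by simp [hG, h0]
  have h3 : 0 < G (x0 + 1) := by
    have := hpos (x0 + 1) (by linarith)
    have h4 : 0 < x0 + 1 - p := by linarith
    simp only [hG]; positivity
  linarith

/-- coefficients -/
noncomputable def lagCoeff (k : ℕ) (α : ℝ) (i : ℕ) : ℝ :=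
  ((-1 : ℝ) ^ i / (Nat.factorial i)) *
      ((∏ j ∈ Finset.range (k - i), (α + (i : ℝ) + (j : ℝ) + 1)) /
        (Nat.factorial (k - i)))

lemma lagCoeff_succ (k : ℕ) (α : ℝ) (i : ℕ) (hi : i < k) :
    lagCoeff k α (i + 1) * (i + 1) * (i + (α + 1)) = ((i : ℝ) - k) * lagCoeff k α i := by
  obtain ⟨n, rfl⟩ : ∃ n, k = i + 1 + n := ⟨k - (i + 1), by omega⟩
  have e1 : i + 1 + n - (i + 1) = n := by omega
  have e2 : i + 1 + n - i = n + 1 := by omega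
  unfold lagCoeff
  rw [e1, e2, Finset.prod_range_succ', Nat.factorial_succ, Nat.factorial_succ]
  have e3 : ∏ j ∈ Finset.range n, (α + ((i + 1 : ℕ) : ℝ) + (j : ℝ) + 1) =
      ∏ j ∈ Finset.range n, (α + (i : ℝ) + ((j + 1 : ℕ) : ℝ) + 1) :=
    Finset.prod_congr rfl (fun j _ => by push_cast; ring)
  rw [e3]
  have h1 : ((i.factorial : ℕ) : ℝ) ≠ 0 := by positivity
  have h2 : ((n.factorial : ℕ) : ℝ) ≠ 0 := by positivity
  have h3 : (i : ℝ) + 1 ≠ 0 := by positivity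
  have h4 : (n : ℝ) + 1 ≠ 0 := by positivity
  push_cast
  field_simp
  ring

open Polynomial in
noncomputable def lagPoly (k : ℕ) (α : ℝ) : Polynomial ℝ :=
  ∑ i ∈ Finset.range (k + 1), monomial i (lagCoeff k α i)

open Polynomial in
lemma lagPoly_eval (k : ℕ) (α x : ℝ) : (lagPoly k α).eval x = laguerre k α x := by
  simp [lagPoly, laguerre, lagCoeff, eval_finsetSum, eval_monomial]

open Polynomial in
lemma lagPoly_coeff (k : ℕ) (α : ℝ) (i : ℕ) :
    (lagPoly k α).coeff i = if i < k + 1 then lagCoeff k α i else 0 := by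
  simp [lagPoly, finsetSum_coeff, coeff_monomial]

open Polynomial in
lemma lagPoly_ode (k : ℕ) (α : ℝ) :
    X * (lagPoly k α).derivative.derivative + (C (α + 1) - X) * (lagPoly k α).derivative
      + C (k : ℝ) * lagPoly k α = 0 := by
  ext i
  have key : (lagPoly k α).coeff (i + 1) * (i + 1) * (i + (α + 1)) =
      ((i : ℝ) - k) * (lagPoly k α).coeff i := by
    rw [lagPoly_coeff, lagPoly_coeff]
    rcases lt_trichotomy i k with h | h | h
    · rw [if_pos (by omega), if_pos (by omega), lagCoeff_succ k α i h]
    · subst h; simp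
    · rw [if_neg (by omega), if_neg (by omega)]; simp
  rw [sub_mul]
  cases i with
  | zero =>
    simp [coeff_derivative] at key ⊢
    linear_combination key
  | succ n =>
    simp only [coeff_add, coeff_sub, coeff_X_mul, coeff_C_mul, coeff_derivative, coeff_zero]
    push_cast at key ⊢
    linear_combination key

lemma laguerre_pos_of_nonpos (k : ℕ) (α : ℝ) (hα : -1 < α) (x : ℝ) (hx : x ≤ 0) :
    0 < laguerre k α x := by
  unfold laguerre
  have hprod : ∀ i n : ℕ, 0 < ∏ j ∈ Finset.range n, (α + (i : ℝ) + (j : ℝ) + 1) := by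
    intro i n
    apply Finset.prod_pos
    intro j _
    have : (0 : ℝ) ≤ i := by positivity
    have : (0 : ℝ) ≤ j := by positivity
    linarith
  apply Finset.sum_pos'
  · intro i _
    have e : ((-1 : ℝ) ^ i / (Nat.factorial i)) *
      ((∏ j ∈ Finset.range (k - i), (α + (i : ℝ) + (j : ℝ) + 1)) /
        (Nat.factorial (k - i))) * x ^ i = (-x) ^ i / (Nat.factorial i) *
      ((∏ j ∈ Finset.range (k - i), (α + (i : ℝ) + (j : ℝ) + 1)) /
        (Nat.factorial (k - i))) := by
      rw [neg_pow]; ring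
    rw [e]
    have h1 : 0 ≤ -x := by linarith
    have := hprod i (k - i)
    positivity
  · refine ⟨0, by simp, ?_⟩
    have := hprod 0 (k - 0)
    positivity

/-- Comparison bound for the largest zero. -/
lemma laguerre_le (k : ℕ) (α : ℝ) (hα : -1 < α) (xk : ℝ) (hroot : laguerre k α xk = 0)
    (hmax : ∀ y : ℝ, laguerre k α y = 0 → y ≤ xk) (m p : ℝ) (hm : m < 1)
    (hq : ∀ x, m ^ 2 * x * (x - p) + 2 * m * x - (x - (α + 1)) * (m * (x - p) + 1)
      + k * (x - p) ≤ 0) : xk ≤ p := by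
  by_contra hlt
  push Not at hlt
  have hx0 : 0 < xk := by
    by_contra h
    have := laguerre_pos_of_nonpos k α hα xk (by linarith)
    linarith
  have ode : ∀ x : ℝ, x * (lagPoly k α).derivative.derivative.eval x +
      ((α + 1) - x) * (lagPoly k α).derivative.eval x + k * (lagPoly k α).eval x = 0 := by
    intro x
    have := congrArg (Polynomial.eval x) (lagPoly_ode k α)
    simpa using this
  have hcont : ContinuousOn (fun x => (lagPoly k α).eval x) (Set.Ioi xk) :=
    (lagPoly k α).continuous.continuousOn
  have hne : ∀ x, xk < x → (lagPoly k α).eval x ≠ 0 := by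
    intro x hx h
    rw [lagPoly_eval] at h
    linarith [hmax x h]
  have hr : (lagPoly k α).eval xk = 0 := by rw [lagPoly_eval, hroot]
  have hsame : (∀ x, xk < x → 0 < (lagPoly k α).eval x) ∨
      (∀ x, xk < x → (lagPoly k α).eval x < 0) := by
    by_contra hcon
    push Not at hcon
    obtain ⟨⟨a, ha, ha'⟩, ⟨b, hb, hb'⟩⟩ := hcon
    have := isPreconnected_Ioi.intermediate_value (Set.mem_Ioi.2 ha) (Set.mem_Ioi.2 hb) hcont
      (Set.mem_Icc.2 ⟨ha', hb'⟩)
    obtain ⟨z, hz, hz'⟩ := this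
    exact hne z hz hz'
  rcases hsame with h | h
  · exact sturm_key (lagPoly k α) k (α + 1) m p xk hx0 hm hlt ode (fun x _ => hq x) hr h
  · refine sturm_key (-lagPoly k α) k (α + 1) m p xk hx0 hm hlt ?_ (fun x _ => hq x) ?_ ?_
    · intro x
      simp only [Polynomial.derivative_neg, Polynomial.eval_neg]
      linear_combination -(ode x)
    · simp [hr]
    · intro x hx
      simpa using h x hx

/-- The tangency point. -/
lemma exists_tangent (k c U : ℝ) (hk : 1 ≤ k) (hc : 0 < c) (hU0 : k + c < U ^ 2)
    (hU : 4 * k * U ^ 2 - (U ^ 2 - c) ^ 2 = 0) :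
    ∃ X Y : ℝ, 0 < X ∧ X ≤ U ^ 2 ∧ c < X ∧ 0 < Y ∧ Y ≤ X - c ∧ Y ^ 2 = 4 * k * X - (X - c) ^ 2 ∧
      Y ^ 3 = 4 * k * X + 2 * c * (X - c) := by
  set s := Real.sqrt (k ^ 2 + 2 * k * c) with hs
  have hs2 : s ^ 2 = k ^ 2 + 2 * k * c := Real.sq_sqrt (by positivity)
  have hs0 : 0 ≤ s := Real.sqrt_nonneg _
  set x1 := c + k + s with hx1
  have e1 : (x1 - c) ^ 2 = 2 * k * x1 := by rw [hx1]; linear_combination hs2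
  have hx1pos : 0 < x1 := by positivity
  have hle : x1 ≤ U ^ 2 := by
    by_contra h
    push Not at h
    nlinarith [mul_pos (by linarith : (0:ℝ) < k) hx1pos]
  set F : ℝ → ℝ := fun x => (Real.sqrt (4 * k * x - (x - c) ^ 2)) ^ 3
    - (4 * k * x + 2 * c * (x - c)) with hF
  have hFc : ContinuousOn F (Set.Icc x1 (U ^ 2)) := by
    apply Continuous.continuousOn
    simp only [hF]; fun_prop
  have hFU : F (U ^ 2) ≤ 0 := by
    simp only [hF]
    rw [hU, Real.sqrt_zero]
    have h5 : 0 < U ^ 2 - c := by linarith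
    have h6 : 0 < 4 * k * U ^ 2 + 2 * c * (U ^ 2 - c) := by positivity
    linarith
  have hF1 : 0 ≤ F x1 := by
    simp only [hF]
    have : 4 * k * x1 - (x1 - c) ^ 2 = (x1 - c) ^ 2 := by linarith
    rw [this, Real.sqrt_sq (by rw [hx1]; linarith)]
    have : (x1 - c) ^ 3 - (4 * k * x1 + 2 * c * (x1 - c)) = 2 * ((x1 - c) * x1 * (k - 1)) := by
      linear_combination (x1 - c + 2) * e1
    rw [this]
    have h1 : 0 ≤ x1 - c := by rw [hx1]; linarith
    have h2 : 0 ≤ k - 1 := by linarith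
    positivity
  obtain ⟨X, hX, hX0⟩ := intermediate_value_Icc' hle hFc (Set.mem_Icc.2 ⟨hFU, hF1⟩)
  have hXc : c < X := by
    have := hX.1
    linarith
  have hXpos : 0 < X := by linarith
  have hY3 : (Real.sqrt (4 * k * X - (X - c) ^ 2)) ^ 3 = 4 * k * X + 2 * c * (X - c) := by
    simp only [hF] at hX0; linarith
  have hY3pos : 0 < 4 * k * X + 2 * c * (X - c) := by
    have : 0 < X - c := by linarith
    positivity
  have hYpos : 0 < Real.sqrt (4 * k * X - (X - c) ^ 2) := by
    rcases (Real.sqrt_nonneg (4 * k * X - (X - c) ^ 2)).eq_or_lt with h | h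
    · rw [← h] at hY3; norm_num at hY3; linarith
    · exact h
  have hY2 := Real.sq_sqrt (Real.sqrt_pos.1 hYpos).le
  refine ⟨X, Real.sqrt (4 * k * X - (X - c) ^ 2), hXpos, hX.2, hXc, hYpos, ?_, hY2, hY3⟩
  apply Real.sqrt_le_iff.2 ⟨by linarith, ?_⟩
  nlinarith [mul_nonneg (by linarith [hX.1] : 0 ≤ X - x1) (by linarith [hX.1] : 0 ≤ X - (c + k) + s)]

lemma quad_nonpos (k c X Y : ℝ) (hX : 0 < X) (hY : 0 < Y) (hYX : Y ≤ X - c) (hc : 0 < c)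
    (h2 : Y ^ 2 = 4 * k * X - (X - c) ^ 2) (h3 : Y ^ 3 = 4 * k * X + 2 * c * (X - c))
    (m p : ℝ) (hm : m = (X - c - Y) / (2 * X)) (hp : p = X - 2 * X / Y) (x : ℝ) :
    m ^ 2 * x * (x - p) + 2 * m * x - (x - c) * (m * (x - p) + 1) + k * (x - p) ≤ 0 := by
  have hm0 : 0 ≤ m := by rw [hm]; apply div_nonneg <;> linarith
  have hm1 : m < 1 := by rw [hm, div_lt_one (by linarith)]; linarith
  have hk : k = (Y ^ 2 + (X - c) ^ 2) / (4 * X) := by field_simp; linarith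
  have e : m ^ 2 * x * (x - p) + 2 * m * x - (x - c) * (m * (x - p) + 1) + k * (x - p)
      = -(m * (1 - m)) * (x - X) ^ 2 := by
    have h3' : Y ^ 3 - Y ^ 2 - X ^ 2 + c ^ 2 = 0 := by linarith
    have h4 : m ^ 2 * x * (x - p) + 2 * m * x - (x - c) * (m * (x - p) + 1) + k * (x - p)
      = -(m * (1 - m)) * (x - X) ^ 2
        + (x - X) * (Y ^ 3 - Y ^ 2 - X ^ 2 + c ^ 2) / (2 * X * Y) := by
      rw [hk, hm, hp]
      field_simp
      ring
    rw [h4, h3']; simp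
  rw [e]
  have : 0 ≤ m * (1 - m) * (x - X) ^ 2 :=
    mul_nonneg (mul_nonneg hm0 (by linarith)) (sq_nonneg _)
  linarith

lemma final_est (X Y U W : ℝ) (hU : 0 < U) (hW : 0 < W) (hY : 0 < Y) (hX : 0 < X)
    (hXU : X ≤ U ^ 2) (hY2 : Y ^ 2 = (U ^ 2 - X) * (W - (U ^ 2 - X))) :
    X - 2 * X / Y < U ^ 2 - 3 * U ^ ((4 : ℝ) / 3) * W ^ (-(1 : ℝ) / 3) + 2 := by
  set d := U ^ 2 - X with hd
  have hd0 : 0 < d := by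
    rcases (by linarith : 0 ≤ d).eq_or_lt with h | h
    · rw [← h] at hY2; nlinarith
    · exact h
  have hdW : d < W := by
    have : 0 < Y ^ 2 := by positivity
    rw [hY2] at this
    linarith [(pos_iff_pos_of_mul_pos this).1 hd0]
  have hYle : Y ≤ Real.sqrt d * Real.sqrt W := by
    rw [← Real.sqrt_mul hd0.le]
    apply Real.le_sqrt_of_sq_le
    nlinarith
  set e := Real.sqrt d with he
  set w := Real.sqrt W with hw
  have he0 : 0 < e := Real.sqrt_pos.2 hd0
  have hw0 : 0 < w := Real.sqrt_pos.2 hW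
  have he2 : e ^ 2 = d := Real.sq_sqrt hd0.le
  have hw2 : w ^ 2 = W := Real.sq_sqrt hW.le
  have hew : e < w := Real.sqrt_lt_sqrt hd0.le hdW
  have h1 : X / (e * w) ≤ X / Y := div_le_div_of_nonneg_left hX.le hY hYle
  have h2 : X / (e * w) = U ^ 2 / (e * w) - e / w := by
    have : X = U ^ 2 - e ^ 2 := by rw [he2, hd]; ring
    rw [this]; field_simp
  have h3 : e / w < 1 := (div_lt_one hw0).2 hew
  set z := U ^ ((4 : ℝ) / 3) * W ^ (-(1 : ℝ) / 3) with hz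
  have hz0 : 0 < z := by positivity
  have hz3 : z ^ 3 = U ^ 4 / W := by
    rw [hz, mul_pow, ← Real.rpow_natCast, ← Real.rpow_natCast, ← Real.rpow_mul hU.le,
      ← Real.rpow_mul hW.le]
    norm_num [Real.rpow_neg_one]
    rw [div_eq_mul_inv]
  -- AM-GM
  have h4 : 3 * z ≤ d + 2 * (U ^ 2 / (e * w)) := by
    set v := U ^ 2 / (e * w) with hv
    have hv0 : 0 < v := by positivity
    have e3 : z ^ 3 = d * v ^ 2 := by
      rw [hz3, hv, ← he2, ← hw2]; field_simp
    by_contra h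
    push Not at h
    have h5 : (d + 2 * v) ^ 3 < (3 * z) ^ 3 := pow_lt_pow_left₀ h (by positivity) (by norm_num)
    have h6 : 27 * (d * v ^ 2) ≤ (d + 2 * v) ^ 3 := by
      nlinarith [mul_nonneg (by positivity : 0 ≤ d + 8 * v) (sq_nonneg (d - v))]
    nlinarith
  have h7 : 2 * X / Y = 2 * (X / Y) := by ring
  rw [h7, mul_assoc, ← hz]
  linarith

/-- The largest zero of `L_k^{(α)}` satisfies
`x_k < U² − 3 U^{4/3} (U² − V²)^{−1/3} + 2`. -/
theorem laguerre_largest_zero_lt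
    (k : ℕ) (hk : 1 ≤ k) (α : ℝ) (hα : -1 < α)
    (V U : ℝ) (hV : V = Real.sqrt ((k : ℝ) + α + 1) - Real.sqrt (k : ℝ))
    (hU : U = Real.sqrt ((k : ℝ) + α + 1) + Real.sqrt (k : ℝ))
    (xk : ℝ) (hroot : laguerre k α xk = 0)
    (hmax : ∀ y : ℝ, laguerre k α y = 0 → y ≤ xk) :
    xk < U ^ 2 - 3 * U ^ ((4 : ℝ) / 3) * (U ^ 2 - V ^ 2) ^ (-(1 : ℝ) / 3) + 2 := by
  have hk' : (1 : ℝ) ≤ k := by exact_mod_cast hk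
  set A := Real.sqrt (k : ℝ) with hA
  set B := Real.sqrt ((k : ℝ) + α + 1) with hB
  have hA0 : 0 < A := Real.sqrt_pos.2 (by linarith)
  have hB0 : 0 < B := Real.sqrt_pos.2 (by linarith)
  have hA2 : A ^ 2 = k := Real.sq_sqrt (by linarith)
  have hB2 : B ^ 2 = k + α + 1 := Real.sq_sqrt (by linarith)
  have hAB : 0 < A * B := mul_pos hA0 hB0
  have hc : α + 1 = B ^ 2 - A ^ 2 := by linarith
  obtain ⟨X, Y, hX, hXU, hXc, hY, hYX, h2, h3⟩ := exists_tangent k (α + 1) U hk' (by linarith)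
    (by rw [hU]; nlinarith) (by rw [hc, hU, ← hA2]; ring)
  have hle : xk ≤ X - 2 * X / Y := by
    refine laguerre_le k α hα xk hroot hmax ((X - (α + 1) - Y) / (2 * X)) _ ?_ ?_
    · rw [div_lt_one (by linarith)]; linarith
    · intro x
      exact quad_nonpos k (α + 1) X Y hX hY hYX (by linarith) h2 h3 _ _ rfl rfl x
  have hW : U ^ 2 - V ^ 2 = 4 * (A * B) := by rw [hU, hV]; ring
  refine lt_of_le_of_lt hle (final_est X Y U (U ^ 2 - V ^ 2) (by rw [hU]; positivity)
    (by rw [hW]; positivity) hY hX hXU ?_)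
  rw [h2, hU, hV, hc, ← hA2]; ring
end

section
/- Let k ≥ 30 and α > 2(3 + 2√3)k − 1. Then the largest zero x_k of the generalized Laguerre polynomial L_k^{(α)} satisfies x_k > U² − 9·U^{4/3} / ((U² − V²)^{1/3} · (2 − 3·k^{−2/3})), where V = √(k+α+1) − √k and U = √(k+α+1) + √k. -/
/-- Coefficient of the Laguerre polynomial. -/
noncomputable def lagC (k : ℕ) (α : ℝ) (i : ℕ) : ℝ :=
  ((-1 : ℝ) ^ i / (Nat.factorial i)) *
      ((∏ j ∈ Finset.range (k - i), (α + (i : ℝ) + (j : ℝ) + 1)) /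
        (Nat.factorial (k - i)))

/-- The Laguerre polynomial as a `Polynomial`. -/
noncomputable def lagP (k : ℕ) (α : ℝ) : Polynomial ℝ :=
  ∑ i ∈ Finset.range (k + 1), Polynomial.monomial i (lagC k α i)

theorem lagP_eval (k : ℕ) (α x : ℝ) : (lagP k α).eval x = laguerre k α x := by
  simp [lagP, laguerre, lagC, Polynomial.eval_finsetSum]

theorem lagP_coeff (k : ℕ) (α : ℝ) (n : ℕ) :
    (lagP k α).coeff n = if n < k + 1 then lagC k α n else 0 := by
  simp [lagP, Polynomial.coeff_monomial]

theorem lagC_rec (k : ℕ) (α : ℝ) (n : ℕ) (h : n < k) :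
    ((n : ℝ) + 1) * (n + 1 + α) * lagC k α (n + 1) = -((k : ℝ) - n) * lagC k α n := by
  obtain ⟨m, rfl⟩ : ∃ m, k = n + 1 + m := ⟨k - (n + 1), by omega⟩
  unfold lagC
  have e1 : n + 1 + m - (n + 1) = m := by omega
  have e2 : n + 1 + m - n = m + 1 := by omega
  rw [e1, e2, Finset.prod_range_succ']
  have e3 : ∏ j ∈ Finset.range m, (α + (n : ℝ) + ((j + 1 : ℕ) : ℝ) + 1)
      = ∏ j ∈ Finset.range m, (α + ((n + 1 : ℕ) : ℝ) + (j : ℝ) + 1) := by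
    apply Finset.prod_congr rfl
    intro j _
    push_cast
    ring
  rw [e3, Nat.factorial_succ, Nat.factorial_succ]
  have h1 : (n.factorial : ℝ) ≠ 0 := by positivity
  have h2 : (m.factorial : ℝ) ≠ 0 := by positivity
  have h3 : (n : ℝ) + 1 ≠ 0 := by positivity
  have h4 : (m : ℝ) + 1 ≠ 0 := by positivity
  push_cast
  field_simp
  ring

open Polynomial in
theorem lagP_ode (k : ℕ) (α : ℝ) :
    X * derivative (derivative (lagP k α)) + (C (α + 1) * derivative (lagP k α)
      - X * derivative (lagP k α)) + C (k : ℝ) * lagP k α = 0 := by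
  have key : ∀ n : ℕ, ((n : ℝ) + 1) * (n + 1 + α) * (lagP k α).coeff (n + 1)
      = -((k : ℝ) - n) * (lagP k α).coeff n := by
    intro n
    rw [lagP_coeff, lagP_coeff]
    rcases lt_trichotomy n k with h | h | h
    · rw [if_pos (by omega), if_pos (by omega), lagC_rec k α n h]
    · subst h; simp
    · rw [if_neg (by omega), if_neg (by omega)]; simp
  ext n
  rcases n with _ | n
  · have := key 0
    simp [coeff_derivative] at this ⊢
    linarith
  · have := key (n + 1)
    simp [coeff_derivative, coeff_X_mul, -map_add, coeff_C_mul] at this ⊢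
    linarith

theorem lag_exists_deriv (k : ℕ) (α : ℝ) : ∃ f1 f2 : ℝ → ℝ,
    (∀ x, HasDerivAt (laguerre k α) (f1 x) x) ∧ (∀ x, HasDerivAt f1 (f2 x) x) ∧
    ∀ x, x * f2 x + (α + 1 - x) * f1 x + k * laguerre k α x = 0 := by
  have e : laguerre k α = fun x => (lagP k α).eval x := by
    funext x; rw [lagP_eval]
  refine ⟨fun x => (Polynomial.derivative (lagP k α)).eval x,
    fun x => (Polynomial.derivative (Polynomial.derivative (lagP k α))).eval x, ?_, ?_, ?_⟩
  · intro x; rw [e]; exact Polynomial.hasDerivAt _ x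
  · intro x; exact Polynomial.hasDerivAt _ x
  · intro x
    have h := congrArg (Polynomial.eval x) (lagP_ode k α)
    simp only [Polynomial.eval_add, Polynomial.eval_sub, Polynomial.eval_mul, Polynomial.eval_X,
      Polynomial.eval_C, Polynomial.eval_zero] at h
    rw [← lagP_eval]
    linarith

/-- Sturm / Jacobi type lemma: there is a zero at or to the right of `c - d`. -/
theorem sturm_core (k : ℕ) (α c v d : ℝ) (hα : -1 < α)
    (hsum : c + v = 2 * (2 * k + α + 1)) (hprod : c * v = (α + 1) ^ 2)
    (hd : 0 < d) (hv : 0 < v) (hdv : d < c - v)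
    (hmain : 80 * c ^ 2 < d ^ 3 * ((c - v) - 4 / 7 * d)) :
    ∃ y, c - d ≤ y ∧ laguerre k α y = 0 := by
  by_contra hne
  push Not at hne
  obtain ⟨f1, f2, hf1, hf2, hode⟩ := lag_exists_deriv k α
  have hc : 0 < c := by linarith
  -- polynomial antiderivative, in the variable w = c - x
  set D := c - v with hD
  let F : ℝ → ℝ := fun x => -((d ^ 2 * (c - x) - 2 * d * (c - x) ^ 2 + 4 / 3 * (c - x) ^ 3)
    - (D * (d ^ 2 * (c - x) ^ 4 / 4 - 2 * d * (c - x) ^ 5 / 5 + (c - x) ^ 6 / 6)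
      - (d ^ 2 * (c - x) ^ 5 / 5 - 2 * d * (c - x) ^ 6 / 6 + (c - x) ^ 7 / 7)) / (4 * c ^ 2))
  let φ : ℝ → ℝ := fun x => (d - (c - x)) * (c - x)
  let φ' : ℝ → ℝ := fun x => 2 * (c - x) - d
  have hF : ∀ x, HasDerivAt F (φ' x ^ 2 - (c - x) * (D - (c - x)) / (4 * c ^ 2) * φ x ^ 2) x := by
    intro x
    have hw : HasDerivAt (fun x : ℝ => c - x) (-1) x := by
      simpa using (hasDerivAt_id x).const_sub c
    have h := (((((hw.const_mul (d ^ 2)).sub ((hw.pow 2).const_mul (2 * d))).add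
      ((hw.pow 3).const_mul (4 / 3))).sub
      ((((((hw.pow 4).const_mul (d ^ 2)).div_const 4).sub
        (((hw.pow 5).const_mul (2 * d)).div_const 5)).add ((hw.pow 6).div_const 6)).const_mul D
        |>.sub ((((((hw.pow 5).const_mul (d ^ 2)).div_const 5).sub
        (((hw.pow 6).const_mul (2 * d)).div_const 6)).add ((hw.pow 7).div_const 7))) |>.div_const (4 * c ^ 2))).neg)
    refine h.congr_deriv ?_
    simp only [φ, φ']
    push_cast
    field_simp
    ring
  have hφ : ∀ x, HasDerivAt φ (φ' x) x := by
    intro x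
    have hw : HasDerivAt (fun x : ℝ => c - x) (-1) x := by
      simpa using (hasDerivAt_id x).const_sub c
    refine ((hw.const_sub d).mul hw).congr_deriv ?_
    simp only [φ']
    ring
  let R : ℝ → ℝ := fun x => f1 x / laguerre k α x + ((α + 1) / 2 * x⁻¹ - 1 / 2)
  have hpos : ∀ x, c - d ≤ x → 0 < x := fun x hx => by linarith
  have hR : ∀ x, c - d ≤ x → HasDerivAt R
      (-(R x) ^ 2 - ((c - x) * (x - v) + 2 * (α + 1)) / (4 * x ^ 2)) x := by
    intro x hx
    have hx0 := hpos x hx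
    have hL := hne x hx
    have h := ((hf2 x).div (hf1 x) hL).add
      (((hasDerivAt_inv hx0.ne').const_mul ((α + 1) / 2)).sub_const (1 / 2))
    refine h.congr_deriv ?_
    have e2 : f2 x = -((α + 1 - x) * f1 x + k * laguerre k α x) / x := by
      have := hode x
      field_simp
      linarith
    have e3 : (c - x) * (x - v) = 2 * (2 * k + α + 1) * x - x ^ 2 - (α + 1) ^ 2 := by
      rw [← hsum, ← hprod]; ring
    rw [e2, e3]
    simp only [R]
    field_simp
    ring
  let G : ℝ → ℝ := fun x => φ x ^ 2 * R x - F x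
  have hG : ∀ x, c - d ≤ x → HasDerivAt G
      (2 * φ x * φ' x * R x + φ x ^ 2 *
        (-(R x) ^ 2 - ((c - x) * (x - v) + 2 * (α + 1)) / (4 * x ^ 2))
        - (φ' x ^ 2 - (c - x) * (D - (c - x)) / (4 * c ^ 2) * φ x ^ 2)) x := by
    intro x hx
    refine ((((hφ x).pow 2).mul (hR x hx)).sub (hF x)).congr_deriv ?_
    simp
  have hanti : AntitoneOn G (Set.Icc (c - d) c) := by
    apply antitoneOn_of_hasDerivWithinAt_nonpos (convex_Icc _ _)
      (f' := fun x => 2 * φ x * φ' x * R x + φ x ^ 2 *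
        (-(R x) ^ 2 - ((c - x) * (x - v) + 2 * (α + 1)) / (4 * x ^ 2))
        - (φ' x ^ 2 - (c - x) * (D - (c - x)) / (4 * c ^ 2) * φ x ^ 2))
    · intro x hx
      exact (hG x hx.1).continuousAt.continuousWithinAt
    · intro x hx
      rw [interior_Icc] at hx
      exact (hG x hx.1.le).hasDerivWithinAt
    · intro x hx
      rw [interior_Icc] at hx
      have hx0 := hpos x hx.1.le
      have hx1 : 0 ≤ c - x := by linarith [hx.2]
      have hx2 : 0 ≤ x - v := by linarith [hx.1]
      have hq : (c - x) * (D - (c - x)) / (4 * c ^ 2)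
          ≤ ((c - x) * (x - v) + 2 * (α + 1)) / (4 * x ^ 2) := by
        have e : (c - x) * (D - (c - x)) = (c - x) * (x - v) := by rw [hD]; ring
        rw [e]
        apply div_le_div₀
        · have := mul_nonneg hx1 hx2
          linarith
        · linarith
        · positivity
        · nlinarith [hx.2]
      have h3 := mul_le_mul_of_nonneg_left hq (sq_nonneg (φ x))
      nlinarith [sq_nonneg (φ' x - φ x * R x)]
  have hle := hanti (Set.left_mem_Icc.2 (by linarith)) (Set.right_mem_Icc.2 (by linarith))
    (by linarith : c - d ≤ c)
  have e1 : G c = 0 := by simp [G, F, φ]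
  have e2 : G (c - d) = d ^ 3 / 3 - (D * d ^ 6 / 60 - d ^ 7 / 105) / (4 * c ^ 2) := by
    simp only [G, F, φ]
    field_simp
    ring
  rw [e1, e2] at hle
  have h5 : (D * d ^ 6 / 60 - d ^ 7 / 105) / (4 * c ^ 2) ≤ d ^ 3 / 3 := by linarith
  rw [div_le_iff₀ (by positivity)] at h5
  have h6 : d ^ 3 * (80 * c ^ 2) < d ^ 3 * (d ^ 3 * (D - 4 / 7 * d)) :=
    mul_lt_mul_of_pos_left hmain (by positivity)
  nlinarith

/-- For `k ≥ 30` and `α > 2(3 + 2√3)k − 1`, the largest zero of `L_k^{(α)}`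
satisfies `x_k > U² − 9 U^{4/3} / ((U² − V²)^{1/3} (2 − 3 k^{−2/3}))`. -/
theorem laguerre_largest_zero_gt_large_alpha
    (k : ℕ) (hk : 30 ≤ k) (α : ℝ)
    (hαgt : 2 * (3 + 2 * Real.sqrt 3) * (k : ℝ) - 1 < α)
    (V U : ℝ) (hV : V = Real.sqrt ((k : ℝ) + α + 1) - Real.sqrt (k : ℝ))
    (hU : U = Real.sqrt ((k : ℝ) + α + 1) + Real.sqrt (k : ℝ))
    (xk : ℝ) (hroot : laguerre k α xk = 0)
    (hmax : ∀ y : ℝ, laguerre k α y = 0 → y ≤ xk) :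
    xk > U ^ 2 - 9 * U ^ ((4 : ℝ) / 3) /
      ((U ^ 2 - V ^ 2) ^ ((1 : ℝ) / 3) * (2 - 3 * (k : ℝ) ^ (-(2 : ℝ) / 3))) := by
  have hk' : (30 : ℝ) ≤ k := by exact_mod_cast hk
  have hk0 : (0 : ℝ) < k := by linarith
  have h3 : (1.7 : ℝ) ≤ Real.sqrt 3 := Real.le_sqrt_of_sq_le (by norm_num)
  have hα9 : 9 * (k : ℝ) ≤ (k : ℝ) + α + 1 := by nlinarith
  set s := Real.sqrt (k : ℝ) with hs
  set t := Real.sqrt ((k : ℝ) + α + 1) with ht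
  have hs2 : s ^ 2 = k := Real.sq_sqrt hk0.le
  have ht2 : t ^ 2 = (k : ℝ) + α + 1 := Real.sq_sqrt (by linarith)
  have hs0 : 0 < s := Real.sqrt_pos.2 hk0
  have ht0 : 0 < t := Real.sqrt_pos.2 (by linarith)
  have hst : 3 * s ≤ t := by
    nlinarith
  have hU0 : 0 < U := by rw [hU]; linarith
  have hV0 : 0 < V := by rw [hV]; linarith
  have hDe : U ^ 2 - V ^ 2 = 4 * s * t := by rw [hU, hV]; ring
  have hD0 : 0 < U ^ 2 - V ^ 2 := by rw [hDe]; positivity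
  have hUD : 3 * s * U ≤ U ^ 2 - V ^ 2 := by
    rw [hDe, hU]; nlinarith
  set D := U ^ 2 - V ^ 2 with hD
  set κ := (k : ℝ) ^ (-(2 : ℝ) / 3) with hκ
  have hκ0 : 0 < κ := Real.rpow_pos_of_pos hk0 _
  have hκ3 : κ ^ 3 * k ^ 2 = 1 := by
    rw [hκ, ← Real.rpow_natCast, ← Real.rpow_mul hk0.le, ← Real.rpow_natCast (k : ℝ) 2,
      ← Real.rpow_add hk0]
    norm_num
  have hκ6 : κ ≤ 1 / 6 := by
    by_contra h
    push Not at h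
    have h1 : (1 / 6 : ℝ) ^ 3 ≤ κ ^ 3 := pow_le_pow_left₀ (by norm_num) h.le 3
    have h2 : (900 : ℝ) ≤ k ^ 2 := by nlinarith
    have h4 := mul_le_mul h1 h2 (by norm_num) (by positivity)
    rw [hκ3] at h4
    norm_num at h4
  set m := 2 - 3 * κ with hm
  have hm1 : 3 / 2 ≤ m := by linarith
  have hm2 : m ≤ 2 := by linarith
  set a := U ^ ((4 : ℝ) / 3) with ha
  set b := D ^ ((1 : ℝ) / 3) with hb
  have ha0 : 0 < a := Real.rpow_pos_of_pos hU0 _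
  have hb0 : 0 < b := Real.rpow_pos_of_pos hD0 _
  have ha3 : a ^ 3 = U ^ 4 := by
    rw [ha, ← Real.rpow_natCast, ← Real.rpow_mul hU0.le, ← Real.rpow_natCast U 4]
    norm_num
  have hb3 : b ^ 3 = D := by
    rw [hb, ← Real.rpow_natCast, ← Real.rpow_mul hD0.le]
    norm_num
  have hm0 : 0 < m := by linarith
  set δ := 9 * a / (b * m) with hδ
  have hδ0 : 0 < δ := by positivity
  have hδ3 : δ ^ 3 * D * m ^ 3 = 729 * U ^ 4 := by
    rw [hδ, ← ha3, ← hb3]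
    field_simp
    norm_num
  have hm3 : (27 / 8 : ℝ) ≤ m ^ 3 := by
    have := pow_le_pow_left₀ (by norm_num) hm1 3
    norm_num at this
    linarith
  have hm8 : m ^ 3 ≤ 8 := by
    have := pow_le_pow_left₀ hm0.le hm2 3
    norm_num at this
    linarith
  have hUD4 : 81 * 900 * U ^ 4 ≤ D ^ 4 := by
    have h1 := pow_le_pow_left₀ (by positivity) hUD 4
    have h2 : (3 * s * U) ^ 4 = 81 * (s ^ 2) ^ 2 * U ^ 4 := by ring
    rw [h2, hs2] at h1
    have h4 : (900 : ℝ) ≤ (k : ℝ) ^ 2 := by nlinarith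
    have h5 : 900 * U ^ 4 ≤ (k : ℝ) ^ 2 * U ^ 4 :=
      mul_le_mul_of_nonneg_right h4 (by positivity)
    linarith
  have hδD : δ ≤ 0.15 * D := by
    by_contra h
    push Not at h
    have h1 : (0.15 * D) ^ 3 < δ ^ 3 := pow_lt_pow_left₀ h (by positivity) (by norm_num)
    have h2 : (0.15 * D) ^ 3 * D < δ ^ 3 * D := mul_lt_mul_of_pos_right h1 hD0
    have h4 : (0.15 * D) ^ 3 * D * (27 / 8) < δ ^ 3 * D * m ^ 3 :=
      mul_lt_mul h2 hm3 (by norm_num) (by positivity)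
    have h5 : (0.15 * D) ^ 3 * D = 0.003375 * D ^ 4 := by ring
    rw [hδ3, h5] at h4
    have h6 : 0 < D ^ 4 := by positivity
    linarith
  have hδU : 729 / 8 * U ^ 4 ≤ δ ^ 3 * D := by
    have := mul_le_mul_of_nonneg_left hm8 (by positivity : 0 ≤ δ ^ 3 * D)
    linarith
  obtain ⟨y, hy, hy0⟩ := sturm_core k α (U ^ 2) (V ^ 2) (0.99 * δ) (by linarith)
    (by
      have : U ^ 2 + V ^ 2 = 2 * (s ^ 2 + t ^ 2) := by rw [hU, hV]; ring
      rw [this, hs2, ht2]; ring) (by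
      have : U * V = t ^ 2 - s ^ 2 := by rw [hU, hV]; ring
      have : U * V = α + 1 := by rw [this, hs2, ht2]; ring
      rw [← this]; ring) (by positivity) (by positivity) (by linarith) (by
      rw [← hD]
      have h1 : 0.915 * D ≤ D - 4 / 7 * (0.99 * δ) := by linarith
      have h2 := mul_le_mul_of_nonneg_left h1 (by positivity : 0 ≤ (0.99 * δ) ^ 3)
      have h5 : 0 < U ^ 4 := by positivity
      have h6 : (0.99 * δ) ^ 3 * (0.915 * D) = 0.99 ^ 3 * 0.915 * (δ ^ 3 * D) := by ring
      have h7 : 80 * (U ^ 2) ^ 2 = 80 * U ^ 4 := by ring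
      rw [h6] at h2
      rw [h7]
      norm_num at h2 ⊢
      linarith)
  have := hmax y hy0
  linarith
end
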